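/- Suppose n ≥ 17 is odd. Let S be a 2-factor of G that is not a tour, containing the path P = {(v1,v2), (v2,v3), (v3,v4)} (v1, v2, v3, v4 distinct) in a cycle C* of S; let T be a path cover of G with (v1,v2), (v2,v3) ∈ T and V1(T) = V \ {v2}; and let T′ be a path cover of G with (v2,v3), (v3,v4) ∈ T′ and V1(T′) = V \ {v3}. Then there exist eight tours H1, …, H8 of G and two tours H, H′ of G such that ℓ(H1) + ⋯ + ℓ(H8) ≤ 2·(2ℓ(S) + ℓ(T) + ℓ(T′)) + ℓ(H) + ℓ(H′) − 2·ℓ(v2, v3). -/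

import Mathlib

variable {V : Type*} [Fintype V] [DecidableEq V]

/-- The degree of vertex `v` in the edge set `F`. -/
def degE (F : Finset (Sym2 V)) (v : V) : ℕ := (F.filter (fun e => v ∈ e)).card

/-- The set of vertices incident to an edge of `F`. -/
def VsetE (F : Finset (Sym2 V)) : Set V := {v | ∃ e ∈ F, v ∈ e}

/-- Vertices incident to exactly one edge of `F`. -/
def V1E (F : Finset (Sym2 V)) : Set V := {v | degE F v = 1}

/-- Vertices incident to exactly two edges of `F`. -/
def V2E (F : Finset (Sym2 V)) : Set V := {v | degE F v = 2}

/-- All edges are genuine edges of the complete graph (no loops). -/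
def SimpleE (F : Finset (Sym2 V)) : Prop := ∀ e ∈ F, ¬ e.IsDiag

/-- `F` is spanning: every vertex is incident to an edge of `F`. -/
def SpanningE (F : Finset (Sym2 V)) : Prop := VsetE F = Set.univ

/-- `F` is a `k`-matching: every vertex has at most `k` incident edges. -/
def IsKMatching (k : ℕ) (F : Finset (Sym2 V)) : Prop :=
  SimpleE F ∧ ∀ v : V, degE F v ≤ k

/-- `F` is a `k`-factor: every vertex has exactly `k` incident edges. -/
def IsKFactor (k : ℕ) (F : Finset (Sym2 V)) : Prop :=
  SimpleE F ∧ ∀ v : V, degE F v = k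

/-- `F` is the edge set of a single (simple) cycle. -/
def IsCycleE (F : Finset (Sym2 V)) : Prop :=
  ∃ m : ℕ, 3 ≤ m ∧ ∃ f : ℕ → V,
    (∀ i < m, ∀ j < m, f i = f j → i = j) ∧
    F = (Finset.range m).image (fun i => s(f i, f ((i + 1) % m)))

/-- `F` contains no cycle. -/
def AcyclicE (F : Finset (Sym2 V)) : Prop :=
  ∀ C : Finset (Sym2 V), C ⊆ F → ¬ IsCycleE C

/-- `F` is the edge set of a simple path with endpoints `a` and `b`. -/
def IsPathE (F : Finset (Sym2 V)) (a b : V) : Prop :=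
  ∃ m : ℕ, 1 ≤ m ∧ ∃ f : ℕ → V,
    (∀ i ≤ m, ∀ j ≤ m, f i = f j → i = j) ∧ f 0 = a ∧ f m = b ∧
    F = (Finset.range m).image (fun i => s(f i, f (i + 1)))

/-- `P` is a maximal path of `F`, i.e. `P ∈ 𝒫(F)`. -/
def MaxPathE (F P : Finset (Sym2 V)) : Prop :=
  P ⊆ F ∧ (∃ a b : V, IsPathE P a b) ∧
  ∀ e ∈ F, (∃ v : V, v ∈ e ∧ v ∈ VsetE P) → e ∈ P

/-- `F` is a path cover: a spanning acyclic 2-matching. -/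
def IsPathCoverE (F : Finset (Sym2 V)) : Prop :=
  IsKMatching 2 F ∧ SpanningE F ∧ AcyclicE F

/-- `F` is a tour: the edge set of a Hamiltonian cycle. -/
def IsTourE (F : Finset (Sym2 V)) : Prop :=
  IsCycleE F ∧ SpanningE F

/-- Total length of the edge set `F`. -/
def lenE (ℓ : Sym2 V → ℝ) (F : Finset (Sym2 V)) : ℝ := ∑ e ∈ F, ℓ e

/-- Minimum length of a tour. -/
noncomputable def optE (ℓ : Sym2 V → ℝ) : ℝ :=
  sInf {x | ∃ H : Finset (Sym2 V), IsTourE H ∧ lenE ℓ H = x}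

/-- Maximum length of a tour. -/
noncomputable def worE (ℓ : Sym2 V → ℝ) : ℝ :=
  sSup {x | ∃ H : Finset (Sym2 V), IsTourE H ∧ lenE ℓ H = x}

/-- The set of edges of `F` incident to `v`. -/
def deltaE (F : Finset (Sym2 V)) (v : V) : Finset (Sym2 V) :=
  F.filter (fun e => v ∈ e)

/-- `(S, T)` is a valid pair of spanning 2-matchings. -/
def ValidPairE (S T : Finset (Sym2 V)) : Prop :=
  IsKMatching 2 S ∧ IsKMatching 2 T ∧ SpanningE S ∧ SpanningE T ∧
  AcyclicE T ∧
  (∀ v : V, v ∈ V2E S → v ∈ V2E T → deltaE S v = deltaE T v) ∧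
  (∀ C : Finset (Sym2 V), C ⊆ S → IsCycleE C →
    ∀ P : Finset (Sym2 V), MaxPathE T P → VsetE C ≠ VsetE P)


set_option linter.unusedSectionVars false

/-- The graph on `V` with edge set `F`. -/
abbrev graphE (F : Finset (Sym2 V)) : SimpleGraph V := SimpleGraph.fromEdgeSet (F : Set (Sym2 V))

/-- `F` is a linear forest: a loopless acyclic edge set with all degrees at most two. -/
structure LinForestE (F : Finset (Sym2 V)) : Prop where
  simple : SimpleE F
  deg_le : ∀ v, degE F v ≤ 2
  acyclic : (graphE F).IsAcyclic

lemma degE_mono {F F' : Finset (Sym2 V)} (h : F ⊆ F') (v : V) : degE F v ≤ degE F' v :=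
  Finset.card_le_card (Finset.filter_subset_filter _ h)

lemma degE_insert {F : Finset (Sym2 V)} {x y : V} (h : s(x, y) ∉ F) (v : V) :
    degE (insert s(x, y) F) v = degE F v + if v = x ∨ v = y then 1 else 0 := by
  unfold degE
  rw [Finset.filter_insert]
  split_ifs with h1 h2 h2
  · rw [Finset.card_insert_of_notMem (by simp [h])]
  · simp at h1; tauto
  · simp at h1; tauto
  · rfl

lemma degE_erase {F : Finset (Sym2 V)} {x y : V} (h : s(x, y) ∈ F) (v : V) :
    degE (F.erase s(x, y)) v + (if v = x ∨ v = y then 1 else 0) = degE F v := by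
  rw [← degE_insert (Finset.notMem_erase _ _), Finset.insert_erase h]

lemma one_le_degE {F : Finset (Sym2 V)} {v x : V} (h : s(v, x) ∈ F) : 1 ≤ degE F v :=
  Finset.card_pos.2 ⟨s(v, x), by simp [h]⟩

lemma two_le_degE {F : Finset (Sym2 V)} {v x y : V} (hx : s(v, x) ∈ F) (hy : s(v, y) ∈ F)
    (hxy : x ≠ y) : 2 ≤ degE F v := by
  have : ({s(v, x), s(v, y)} : Finset (Sym2 V)) ⊆ F.filter (fun e => v ∈ e) := by
    intro e he
    simp only [Finset.mem_insert, Finset.mem_singleton] at he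
    rcases he with rfl | rfl <;> simp [hx, hy]
  calc 2 = ({s(v, x), s(v, y)} : Finset (Sym2 V)).card := by
        rw [Finset.card_pair (by simpa only [ne_eq, Sym2.congr_right])]
    _ ≤ _ := Finset.card_le_card this

lemma three_le_degE {F : Finset (Sym2 V)} {v x y z : V} (hx : s(v, x) ∈ F) (hy : s(v, y) ∈ F)
    (hz : s(v, z) ∈ F) (hxy : x ≠ y) (hxz : x ≠ z) (hyz : y ≠ z) : 3 ≤ degE F v := by
  have : ({s(v, x), s(v, y), s(v, z)} : Finset (Sym2 V)) ⊆ F.filter (fun e => v ∈ e) := by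
    intro e he
    simp only [Finset.mem_insert, Finset.mem_singleton] at he
    rcases he with rfl | rfl | rfl <;> simp [hx, hy, hz]
  calc 3 = ({s(v, x), s(v, y), s(v, z)} : Finset (Sym2 V)).card := by
        rw [Finset.card_eq_three.2 ⟨_, _, _, _, _, _, rfl⟩] <;> simpa only [ne_eq, Sym2.congr_right]
    _ ≤ _ := Finset.card_le_card this

lemma SimpleE.ne {F : Finset (Sym2 V)} (hF : SimpleE F) {x y : V} (h : s(x, y) ∈ F) : x ≠ y := by
  simpa using hF _ h

lemma SimpleE.insert_edge {F : Finset (Sym2 V)} (hF : SimpleE F) {x y : V} (h : x ≠ y) :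
    SimpleE (insert s(x, y) F) := by
  intro e he
  rcases Finset.mem_insert.1 he with rfl | he
  · simpa using h
  · exact hF e he

lemma graphE_adj {F : Finset (Sym2 V)} (hF : SimpleE F) {x y : V} :
    (graphE F).Adj x y ↔ s(x, y) ∈ F := by
  simp only [SimpleGraph.fromEdgeSet_adj, Finset.mem_coe, and_iff_left_iff_imp]
  exact hF.ne

lemma reachable_of_mem {F : Finset (Sym2 V)} {x y : V} (h : s(x, y) ∈ F) :
    (graphE F).Reachable x y := by
  by_cases hxy : x = y
  · rw [hxy]
  · exact SimpleGraph.Adj.reachable (by simp [h, hxy])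

lemma graphE_mono {F F' : Finset (Sym2 V)} (h : F ⊆ F') : graphE F ≤ graphE F' :=
  SimpleGraph.fromEdgeSet_mono (by exact_mod_cast h)

lemma sum_degE {F : Finset (Sym2 V)} (hF : SimpleE F) : ∑ v, degE F v = 2 * F.card := by
  unfold degE
  simp only [Finset.card_filter]
  rw [Finset.sum_comm, mul_comm, ← smul_eq_mul, ← Finset.sum_const]
  refine Finset.sum_congr rfl fun e he => ?_
  induction e using Sym2.ind with
  | _ x y =>
    have hxy := hF.ne he
    rw [← Finset.card_filter]
    rw [show (Finset.univ.filter fun v => v ∈ s(x, y)) = {x, y} by ext; simp]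
    exact Finset.card_pair hxy

/-- A set of vertices closed under adjacency contains everything reachable from it. -/
lemma mem_of_reachable {G : SimpleGraph V} {A : Set V} (hA : ∀ x ∈ A, ∀ y, G.Adj x y → y ∈ A)
    {x y : V} (hx : x ∈ A) (h : G.Reachable x y) : y ∈ A := by
  obtain ⟨p⟩ := h
  induction p with
  | nil => exact hx
  | cons hadj _ ih => exact ih (hA _ hx _ hadj)

lemma reachable_insert {F : Finset (Sym2 V)} {x y u w : V}
    (h : (graphE (insert s(x, y) F)).Reachable u w) :
    (graphE F).Reachable u w ∨ ((graphE F).Reachable u x ∧ (graphE F).Reachable y w) ∨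
      ((graphE F).Reachable u y ∧ (graphE F).Reachable x w) := by
  refine mem_of_reachable (G := graphE (insert s(x, y) F)) (A := {w |
    (graphE F).Reachable u w ∨ ((graphE F).Reachable u x ∧ (graphE F).Reachable y w) ∨
      ((graphE F).Reachable u y ∧ (graphE F).Reachable x w)}) ?_ (Or.inl .rfl) h
  intro a ha b hab
  simp only [Set.mem_ofPred_eq] at ha ⊢
  simp only [Finset.coe_insert, SimpleGraph.fromEdgeSet_adj, Set.mem_insert_iff,
    Finset.mem_coe] at hab
  rcases hab.1 with he | he
  · rcases Sym2.eq_iff.1 he with ⟨rfl, rfl⟩ | ⟨rfl, rfl⟩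
    · rcases ha with h1 | h1 | h1
      · exact Or.inr (Or.inl ⟨h1, .rfl⟩)
      · exact Or.inr (Or.inl ⟨h1.1, .rfl⟩)
      · exact Or.inl h1.1
    · rcases ha with h1 | h1 | h1
      · exact Or.inr (Or.inr ⟨h1, .rfl⟩)
      · exact Or.inl h1.1
      · exact Or.inr (Or.inr ⟨h1.1, .rfl⟩)
  · have hr := reachable_of_mem he
    rcases ha with h1 | h1 | h1
    · exact Or.inl (h1.trans hr)
    · exact Or.inr (Or.inl ⟨h1.1, h1.2.trans hr⟩)
    · exact Or.inr (Or.inr ⟨h1.1, h1.2.trans hr⟩)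

/-- In a graph of maximum degree two, a path joining two leaves fills its component. -/
lemma mem_support_of_reachable {F : Finset (Sym2 V)} (hF : SimpleE F) (hd : ∀ v, degE F v ≤ 2)
    {u v w : V} (p : (graphE F).Walk u v) (hp : p.IsPath) (huv : u ≠ v) (hu : degE F u ≤ 1)
    (hv : degE F v ≤ 1) (h : (graphE F).Reachable u w) : w ∈ p.support := by
  refine mem_of_reachable (A := {w | w ∈ p.support}) ?_ p.start_mem_support h
  intro x hx y hxy
  rw [graphE_adj hF] at hxy
  obtain ⟨i, rfl, hi⟩ := SimpleGraph.Walk.mem_support_iff_exists_getVert.1 hx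
  have hlen : 0 < p.length := by
    rw [Nat.pos_iff_ne_zero]
    exact fun h0 => huv (SimpleGraph.Walk.eq_of_length_eq_zero h0)
  have hsucc : ∀ j < p.length, s(p.getVert j, p.getVert (j + 1)) ∈ F := fun j hj =>
    (graphE_adj hF).1 (p.adj_getVert_succ hj)
  by_contra hy
  have hne : ∀ j, p.getVert j ≠ y := fun j hj => hy (hj ▸ p.getVert_mem_support j)
  rcases Nat.eq_zero_or_pos i with rfl | hi0
  · have := two_le_degE (hsucc 0 hlen) hxy (hne _)
    rw [p.getVert_zero] at this; omega
  obtain ⟨j, rfl⟩ : ∃ j, i = j + 1 := ⟨i - 1, by omega⟩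
  have hprev := hsucc j (by omega)
  rw [Sym2.eq_swap] at hprev
  rcases hi.lt_or_eq with hlt | heq
  · have hne' : p.getVert j ≠ p.getVert (j + 1 + 1) := by
      intro hEq
      have := hp.getVert_injOn (x₁ := j) (x₂ := j + 1 + 1) (by simp; omega) (by simp; omega) hEq
      omega
    have := three_le_degE hprev (hsucc (j + 1) hlt) hxy hne' (hne _) (hne _)
    have := hd (p.getVert (j + 1))
    omega
  · have := two_le_degE hprev hxy (hne _)
    rw [heq, p.getVert_length] at this; omega

/-- A component of a graph of maximum degree two has at most two leaves. -/
lemma not_three_leaves {F : Finset (Sym2 V)} (hF : SimpleE F) (hd : ∀ v, degE F v ≤ 2)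
    {u v w : V} (huv : u ≠ v) (huw : u ≠ w) (hvw : v ≠ w) (hu : degE F u ≤ 1)
    (hv : degE F v ≤ 1) (hw : degE F w ≤ 1) (h1 : (graphE F).Reachable u v) :
    ¬ (graphE F).Reachable u w := by
  intro h2
  obtain ⟨p, hp⟩ := h1.exists_isPath
  have hmem := mem_support_of_reachable hF hd p hp huv hu hv h2
  obtain ⟨i, rfl, hi⟩ := SimpleGraph.Walk.mem_support_iff_exists_getVert.1 hmem
  have hi0 : i ≠ 0 := fun h => huw (by rw [h, p.getVert_zero])
  have hil : i ≠ p.length := fun h => hvw (by rw [h, p.getVert_length])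
  obtain ⟨j, rfl⟩ : ∃ j, i = j + 1 := ⟨i - 1, by omega⟩
  have hprev := (graphE_adj hF).1 (p.adj_getVert_succ (i := j) (by omega))
  have hnext := (graphE_adj hF).1 (p.adj_getVert_succ (i := j + 1) (by omega))
  rw [Sym2.eq_swap] at hprev
  have := two_le_degE hprev hnext (by
      intro hEq
      have := hp.getVert_injOn (x₁ := j) (x₂ := j + 1 + 1) (by simp; omega) (by simp; omega) hEq
      omega)
  omega

/-- Closing up a path of length at least two gives a cycle. -/
lemma isCycleE_insert_path {G : SimpleGraph V} {a b : V} (p : G.Walk a b) (hp : p.IsPath)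
    (hlen : 2 ≤ p.length) :
    IsCycleE (insert s(a, b)
      ((Finset.range p.length).image fun i => s(p.getVert i, p.getVert (i + 1)))) := by
  refine ⟨p.length + 1, by omega, p.getVert, ?_, ?_⟩
  · intro i hi j hj hij
    exact hp.getVert_injOn (by simp; omega) (by simp; omega) hij
  · rw [Finset.range_add_one, Finset.image_insert, Nat.mod_self, p.getVert_length, p.getVert_zero,
      Sym2.eq_swap]
    congr 1
    refine Finset.image_congr fun i hi => ?_
    have : i < p.length := by simpa using hi
    rw [Nat.mod_eq_of_lt (by omega)]

lemma exists_isCycleE_of_reachable {F : Finset (Sym2 V)} (hF : SimpleE F) {x y : V} (hxy : x ≠ y)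
    (hmem : s(x, y) ∉ F) (h : (graphE F).Reachable x y) :
    ∃ C ⊆ insert s(x, y) F, IsCycleE C := by
  obtain ⟨p, hp⟩ := h.exists_isPath
  have h0 : p.length ≠ 0 := fun h => hxy (SimpleGraph.Walk.eq_of_length_eq_zero h)
  have h1 : p.length ≠ 1 := fun h =>
    hmem ((graphE_adj hF).1 (SimpleGraph.Walk.adj_of_length_eq_one h))
  refine ⟨_, ?_, isCycleE_insert_path p hp (by omega)⟩
  refine Finset.insert_subset_insert _ fun e he => ?_
  obtain ⟨i, hi, rfl⟩ := Finset.mem_image.1 he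
  exact (graphE_adj hF).1 (p.adj_getVert_succ (by simpa using hi))

lemma isAcyclic_of_acyclicE {F : Finset (Sym2 V)} (hF : SimpleE F) (h : AcyclicE F) :
    (graphE F).IsAcyclic := by
  rw [SimpleGraph.isAcyclic_iff_forall_adj_isBridge]
  intro x y hxy
  have hmem := (graphE_adj hF).1 hxy
  rw [SimpleGraph.isBridge_iff]
  intro hr
  have hle : (graphE F).deleteEdges {s(x, y)} ≤ graphE (F.erase s(x, y)) := by
    intro a b hab
    simp only [SimpleGraph.deleteEdges_adj, SimpleGraph.fromEdgeSet_adj, Finset.mem_coe,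
      Set.mem_singleton_iff, Finset.coe_erase, Set.mem_sdiff] at hab ⊢
    tauto
  obtain ⟨C, hC, hcyc⟩ := exists_isCycleE_of_reachable
    (fun e he => hF e (Finset.mem_of_mem_erase he)) hxy.ne (Finset.notMem_erase _ F) (hr.mono hle)
  rw [Finset.insert_erase hmem] at hC
  exact h C hC hcyc

lemma exists_isCycleE_of_not_linForestE {F : Finset (Sym2 V)} (hF : SimpleE F)
    (hd : ∀ v, degE F v ≤ 2) (h : ¬ LinForestE F) : ∃ C ⊆ F, IsCycleE C := by
  by_contra! hC
  exact h ⟨hF, hd, isAcyclic_of_acyclicE hF hC⟩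

lemma LinForestE.insert_edge {F : Finset (Sym2 V)} (hF : LinForestE F) {x y : V} (hxy : x ≠ y)
    (hx : degE F x ≤ 1) (hy : degE F y ≤ 1) (h : ¬ (graphE F).Reachable x y) :
    LinForestE (insert s(x, y) F) := by
  have hmem : s(x, y) ∉ F := fun hm => h (reachable_of_mem hm)
  refine ⟨hF.simple.insert_edge hxy, fun v => ?_, ?_⟩
  · rw [degE_insert hmem]
    have := hF.deg_le v
    split_ifs with hv
    · rcases hv with rfl | rfl <;> omega
    · omega
  · have := hF.acyclic.sup_edge_of_not_reachable h
    refine this.anti ?_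
    intro a b hab
    simp only [SimpleGraph.fromEdgeSet_adj, SimpleGraph.sup_adj, SimpleGraph.edge_adj,
      Finset.coe_insert, Set.mem_insert_iff, Finset.mem_coe] at hab ⊢
    rcases hab with ⟨h1 | h1, h2⟩
    · right; simp at h1; exact ⟨by tauto, h2⟩
    · exact Or.inl ⟨h1, h2⟩

lemma card_edgeFinset_graphE {F : Finset (Sym2 V)} (hF : SimpleE F) :
    (graphE F).edgeSet.ncard = F.card := by
  rw [← Set.ncard_coe_finset]
  congr 1
  ext e
  induction e using Sym2.ind with
  | _ x y => simp only [SimpleGraph.mem_edgeSet, graphE_adj hF, Finset.mem_coe]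

lemma exists_isTree_ge [Nonempty V] {G : SimpleGraph V} (hG : G.IsAcyclic) :
    ∃ T, G ≤ T ∧ T.IsTree := by
  obtain ⟨T, h, _, hT⟩ :=
    SimpleGraph.Connected.exists_isTree_le_of_le_of_isAcyclic (G := (⊤ : SimpleGraph V))
      SimpleGraph.connected_top le_top hG
  exact ⟨T, h, hT⟩

lemma LinForestE.card_add_one_le [Nonempty V] {F : Finset (Sym2 V)} (hF : LinForestE F) :
    F.card + 1 ≤ Fintype.card V := by
  obtain ⟨T, hle, hT⟩ := exists_isTree_ge hF.acyclic
  have h := (SimpleGraph.isTree_iff_connected_and_card.1 hT).2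
  rw [Nat.card_coe_set_eq, Nat.card_eq_fintype_card] at h
  rw [← card_edgeFinset_graphE hF.simple, ← h]
  exact Nat.add_le_add_right
    (Set.ncard_le_ncard (SimpleGraph.edgeSet_mono hle) (Set.toFinite _)) 1

lemma LinForestE.connected_of_card [Nonempty V] {F : Finset (Sym2 V)} (hF : LinForestE F)
    (hc : F.card + 1 = Fintype.card V) : (graphE F).Connected := by
  obtain ⟨T, hle, hT⟩ := exists_isTree_ge hF.acyclic
  have h := (SimpleGraph.isTree_iff_connected_and_card.1 hT).2
  rw [Nat.card_coe_set_eq, Nat.card_eq_fintype_card] at h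
  have heq : (graphE F).edgeSet = T.edgeSet := by
    refine Set.eq_of_subset_of_ncard_le (SimpleGraph.edgeSet_mono hle) ?_ (Set.toFinite _)
    rw [card_edgeFinset_graphE hF.simple]; omega
  rw [SimpleGraph.edgeSet_inj.1 heq]
  exact hT.connected

lemma two_mul_card_add {F : Finset (Sym2 V)} (hF : SimpleE F) {B : Finset V}
    (h1 : ∀ v ∈ B, degE F v = 1) (h2 : ∀ v ∉ B, degE F v = 2) :
    2 * F.card + B.card = 2 * Fintype.card V := by
  have hs : ∑ v, (degE F v + if v ∈ B then 1 else 0) = ∑ _v : V, 2 := by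
    refine Finset.sum_congr rfl fun v _ => ?_
    split_ifs with hv
    · rw [h1 v hv]
    · rw [h2 v hv]
  rw [Finset.sum_add_distrib, sum_degE hF] at hs
  simp only [Finset.sum_boole, Finset.filter_mem_eq_inter, Finset.univ_inter, Finset.sum_const,
    Finset.card_univ, smul_eq_mul, Nat.cast_id] at hs
  omega

/-- A linear forest whose only leaves are `a` and `b` is closed up to a tour by `s(a, b)`. -/
lemma LinForestE.isTourE_insert (hV : 3 ≤ Fintype.card V) {F : Finset (Sym2 V)}
    (hF : LinForestE F) {a b : V} (hab : a ≠ b)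
    (hd : ∀ v, degE F v = if v = a ∨ v = b then 1 else 2) : IsTourE (insert s(a, b) F) := by
  have : Nonempty V := ⟨a⟩
  have hcard := two_mul_card_add hF.simple (B := {a, b})
    (fun v hv => by rw [hd, if_pos (by simpa using hv)])
    (fun v hv => by rw [hd, if_neg (by simpa using hv)])
  rw [Finset.card_pair hab] at hcard
  have hconn := hF.connected_of_card (by omega)
  obtain ⟨p, hp⟩ := (hconn.preconnected a b).exists_isPath
  have hall : ∀ w, w ∈ p.support := fun w => mem_support_of_reachable hF.simple hF.deg_le p hp hab
    (by rw [hd]; simp) (by rw [hd]; simp) (hconn.preconnected a w)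
  have hlen : p.length + 1 = Fintype.card V := by
    rw [← p.length_support, ← List.toFinset_card_of_nodup hp.support_nodup]
    rw [show p.support.toFinset = Finset.univ by ext w; simp [hall w], Finset.card_univ]
  have hinj : Set.InjOn (fun i => s(p.getVert i, p.getVert (i + 1)))
      (Finset.range p.length : Set ℕ) := by
    intro i hi j hj hij
    simp only [Finset.coe_range, Set.mem_Iio] at hi hj
    have hg : ∀ k l, k ≤ p.length → l ≤ p.length → p.getVert k = p.getVert l → k = l :=
      fun k l hk hl h => hp.getVert_injOn hk hl h
    rcases Sym2.eq_iff.1 hij with ⟨h, _⟩ | ⟨h, h'⟩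
    · exact hg i j hi.le hj.le h
    · have := hg _ _ (by omega) (by omega) h
      have := hg _ _ (by omega) (by omega) h'
      omega
  have hsub : ((Finset.range p.length).image fun i => s(p.getVert i, p.getVert (i + 1))) = F := by
    refine Finset.eq_of_subset_of_card_le ?_ ?_
    · intro e he
      obtain ⟨i, hi, rfl⟩ := Finset.mem_image.1 he
      exact (graphE_adj hF.simple).1 (p.adj_getVert_succ (by simpa using hi))
    · rw [Finset.card_image_of_injOn hinj, Finset.card_range]; omega
  have hcyc := isCycleE_insert_path p hp (by omega)
  rw [hsub] at hcyc
  refine ⟨hcyc, Set.eq_univ_of_forall fun v => ?_⟩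
  have hpos : 0 < degE F v := by rw [hd]; split_ifs <;> omega
  obtain ⟨e, he⟩ := Finset.card_pos.1 hpos
  rw [Finset.mem_filter] at he
  exact ⟨e, Finset.mem_insert_of_mem he.1, he.2⟩

lemma IsCycleE.exists_neighbors {C : Finset (Sym2 V)} (hC : IsCycleE C) {v : V}
    (hv : v ∈ VsetE C) :
    ∃ x y, x ≠ y ∧ x ≠ v ∧ y ≠ v ∧ s(v, x) ∈ C ∧ s(v, y) ∈ C := by
  obtain ⟨m, hm, f, hf, rfl⟩ := hC
  have hmem : ∀ i < m, s(f i, f ((i + 1) % m)) ∈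
      (Finset.range m).image (fun i => s(f i, f ((i + 1) % m))) := fun i hi =>
    Finset.mem_image_of_mem (fun i => s(f i, f ((i + 1) % m))) (Finset.mem_range.2 hi)
  obtain ⟨i, hi, rfl⟩ : ∃ i < m, f i = v := by
    obtain ⟨e, he, hve⟩ := hv
    obtain ⟨j, hj, rfl⟩ := Finset.mem_image.1 he
    rcases Sym2.mem_iff.1 hve with rfl | rfl
    · exact ⟨j, by simpa using hj, rfl⟩
    · exact ⟨_, Nat.mod_lt _ (by omega), rfl⟩
  obtain ⟨k, hk, hki, hkm⟩ : ∃ k < m, k ≠ i ∧ s(f i, f k) ∈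
      (Finset.range m).image (fun i => s(f i, f ((i + 1) % m))) ∧ k = (i + 1) % m := by
    refine ⟨(i + 1) % m, Nat.mod_lt _ (by omega), ?_, hmem i hi, rfl⟩
    rcases Nat.lt_or_ge (i + 1) m with h | h
    · rw [Nat.mod_eq_of_lt h]; omega
    · rw [show i + 1 = m by omega, Nat.mod_self]; omega
  obtain ⟨l, hl, hli, hlm, hle⟩ : ∃ l < m, l ≠ i ∧ s(f i, f l) ∈
      (Finset.range m).image (fun i => s(f i, f ((i + 1) % m))) ∧ i = (l + 1) % m := by
    rcases Nat.eq_zero_or_pos i with rfl | hi0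
    · refine ⟨m - 1, by omega, by omega, ?_, ?_⟩
      · have := hmem (m - 1) (by omega)
        rwa [Nat.sub_add_cancel (by omega), Nat.mod_self, Sym2.eq_swap] at this
      · rw [Nat.sub_add_cancel (by omega), Nat.mod_self]
    · refine ⟨i - 1, by omega, by omega, ?_, ?_⟩
      · have := hmem (i - 1) (by omega)
        rwa [Nat.sub_add_cancel hi0, Nat.mod_eq_of_lt hi, Sym2.eq_swap] at this
      · rw [Nat.sub_add_cancel hi0, Nat.mod_eq_of_lt hi]
  refine ⟨f k, f l, ?_, fun h => hki (hf _ hk _ hi h), fun h => hli (hf _ hl _ hi h), hkm.1, hlm⟩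
  intro h
  have hkl := hf _ hk _ hl h
  have h1 := hkm.2
  rcases Nat.lt_or_ge (i + 1) m with h2 | h2
  · rw [Nat.mod_eq_of_lt h2] at h1
    rcases Nat.lt_or_ge (l + 1) m with h3 | h3
    · rw [Nat.mod_eq_of_lt h3] at hle; omega
    · rw [show l + 1 = m by omega, Nat.mod_self] at hle; omega
  · rw [show i + 1 = m by omega, Nat.mod_self] at h1
    rw [Nat.mod_eq_of_lt (by omega)] at hle; omega

lemma IsCycleE.reachable {C : Finset (Sym2 V)} (hC : IsCycleE C) {v w : V}
    (hv : v ∈ VsetE C) (hw : w ∈ VsetE C) : (graphE C).Reachable v w := by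
  obtain ⟨m, hm, f, hf, rfl⟩ := hC
  set C := (Finset.range m).image (fun i => s(f i, f ((i + 1) % m))) with hCdef
  have hmem : ∀ i < m, s(f i, f ((i + 1) % m)) ∈ C := fun i hi =>
    Finset.mem_image_of_mem (fun i => s(f i, f ((i + 1) % m))) (Finset.mem_range.2 hi)
  have h0 : ∀ i < m, (graphE C).Reachable (f 0) (f i) := by
    intro i hi
    induction i with
    | zero => exact .rfl
    | succ i ih =>
      have := hmem i (by omega)
      rw [Nat.mod_eq_of_lt hi] at this
      exact (ih (by omega)).trans (reachable_of_mem this)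
  have key : ∀ v ∈ VsetE C, (graphE C).Reachable (f 0) v := by
    rintro v ⟨e, he, hve⟩
    obtain ⟨j, hj, rfl⟩ := Finset.mem_image.1 he
    rcases Sym2.mem_iff.1 hve with rfl | rfl
    · exact h0 _ (by simpa using hj)
    · exact h0 _ (Nat.mod_lt _ (by omega))
  exact (key v hv).symm.trans (key w hw)

/-- If `S` has maximum degree two, every edge of `S` at a vertex of a cycle of `S` lies on it. -/
lemma IsCycleE.mem_of_mem {C S : Finset (Sym2 V)} (hC : IsCycleE C) (hCS : C ⊆ S)
    (hd : ∀ v, degE S v ≤ 2) {v w : V} (hv : v ∈ VsetE C) (h : s(v, w) ∈ S) : s(v, w) ∈ C := by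
  obtain ⟨x, y, hxy, -, -, hx, hy⟩ := hC.exists_neighbors hv
  by_contra hw
  have := three_le_degE (hCS hx) (hCS hy) h hxy (fun e => hw (e ▸ hx)) (fun e => hw (e ▸ hy))
  have := hd v
  omega

lemma IsCycleE.mem_VsetE_of_reachable {C S : Finset (Sym2 V)} (hC : IsCycleE C) (hCS : C ⊆ S)
    (hd : ∀ v, degE S v ≤ 2) {v w : V} (hv : v ∈ VsetE C) (h : (graphE S).Reachable v w) :
    w ∈ VsetE C := by
  refine mem_of_reachable (fun x hx y hxy => ?_) hv h
  have hmem : s(x, y) ∈ S := by simpa using (SimpleGraph.fromEdgeSet_adj _ |>.1 hxy).1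
  exact ⟨_, hC.mem_of_mem hCS hd hx hmem, Sym2.mem_mk_right _ _⟩

/-- Two cycles of a graph of maximum degree two that share a vertex coincide. -/
lemma IsCycleE.eq_of_mem {C D S : Finset (Sym2 V)} (hC : IsCycleE C) (hCS : C ⊆ S)
    (hD : IsCycleE D) (hDS : D ⊆ S) (hd : ∀ v, degE S v ≤ 2) {v : V} (hvC : v ∈ VsetE C)
    (hvD : v ∈ VsetE D) : C = D := by
  have key : ∀ {C D : Finset (Sym2 V)}, IsCycleE C → C ⊆ S → IsCycleE D → D ⊆ S →
      v ∈ VsetE C → v ∈ VsetE D → C ⊆ D := by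
    intro C D hC hCS hD hDS hvC hvD e he
    induction e using Sym2.ind with
    | _ x y =>
      have hx : x ∈ VsetE C := ⟨_, he, Sym2.mem_mk_left _ _⟩
      exact hD.mem_of_mem hDS hd (hD.mem_VsetE_of_reachable hDS hd hvD
        ((hC.reachable hvC hx).mono (graphE_mono hCS))) (hCS he)
  exact (key hC hCS hD hDS hvC hvD).antisymm (key hD hDS hC hCS hvD hvC)

/-- Some vertex of `B` is connected in `F` to no other vertex of `B`. -/
def HasIsolatedIn (F : Finset (Sym2 V)) (B : Finset V) : Prop :=
  ∃ u ∈ B, ∀ x ∈ B, x ≠ u → ¬ (graphE F).Reachable u x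

lemma LinForestE.exists_linkable_pair {F₁ F₂ : Finset (Sym2 V)} (h₁ : LinForestE F₁)
    (h₂ : LinForestE F₂) {B : Finset V} (hB₁ : ∀ v ∈ B, degE F₁ v ≤ 1)
    (hB₂ : ∀ v ∈ B, degE F₂ v ≤ 1) (hB : 4 ≤ B.card) :
    ∃ x ∈ B, ∃ y ∈ B, x ≠ y ∧ ¬ (graphE F₁).Reachable x y ∧ ¬ (graphE F₂).Reachable x y ∧
      (HasIsolatedIn F₂ B → HasIsolatedIn (insert s(x, y) F₂) ((B.erase x).erase y)) := by
  classical
  have bad : ∀ {F : Finset (Sym2 V)}, LinForestE F → (∀ v ∈ B, degE F v ≤ 1) → ∀ x ∈ B,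
      ((B.erase x).filter fun y => (graphE F).Reachable x y).card ≤ 1 := by
    intro F hF hd x hx
    refine Finset.card_le_one.2 fun a ha b hb => ?_
    simp only [Finset.mem_filter, Finset.mem_erase] at ha hb
    by_contra hab
    exact not_three_leaves hF.simple hF.deg_le (Ne.symm ha.1.1) (Ne.symm hb.1.1) hab (hd x hx)
      (hd a ha.1.2) (hd b hb.1.2) ha.2 hb.2
  have hy : ∀ x ∈ B, ∃ y ∈ B, x ≠ y ∧ ¬ (graphE F₁).Reachable x y ∧
      ¬ (graphE F₂).Reachable x y := by
    intro x hx
    by_contra! hcon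
    have hsub : B.erase x ⊆ ((B.erase x).filter fun y => (graphE F₁).Reachable x y) ∪
        ((B.erase x).filter fun y => (graphE F₂).Reachable x y) := by
      intro y hy
      have := hcon y (Finset.mem_of_mem_erase hy) (Finset.ne_of_mem_erase hy).symm
      simp only [Finset.mem_union, Finset.mem_filter]
      tauto
    have h := (Finset.card_le_card hsub).trans (Finset.card_union_le _ _)
    have := bad h₁ hB₁ x hx
    have := bad h₂ hB₂ x hx
    rw [Finset.card_erase_of_mem hx] at h
    omega
  by_cases hpair : ∃ x ∈ B, ∃ x' ∈ B, x ≠ x' ∧ (graphE F₂).Reachable x x'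
  · obtain ⟨x, hx, x', hx', hxx', hr⟩ := hpair
    obtain ⟨y, hyB, hxy, hr₁, hr₂⟩ := hy x hx
    refine ⟨x, hx, y, hyB, hxy, hr₁, hr₂, ?_⟩
    rintro ⟨u, hu, hlone⟩
    have hux : x ≠ u := by
      rintro rfl
      exact hlone x' hx' hxx'.symm hr
    by_cases huy : y = u
    · subst huy
      have hx'y : x' ≠ y := by rintro rfl; exact hr₂ hr
      refine ⟨x', by simp [hx', hx'y, hxx'.symm], fun z hz hzx' hreach => ?_⟩
      simp only [Finset.mem_erase] at hz
      rcases reachable_insert hreach with h | ⟨-, h⟩ | ⟨h, -⟩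
      · exact not_three_leaves h₂.simple h₂.deg_le hxx' (Ne.symm hz.2.1) (Ne.symm hzx')
          (hB₂ _ hx) (hB₂ _ hx') (hB₂ _ hz.2.2) hr (hr.trans h)
      · exact hlone z hz.2.2 hz.1 h
      · exact hlone x' hx' hx'y h.symm
    · refine ⟨u, by simp [hu, Ne.symm hux, Ne.symm huy], fun z hz hzu hreach => ?_⟩
      simp only [Finset.mem_erase] at hz
      rcases reachable_insert hreach with h | ⟨h, -⟩ | ⟨h, -⟩
      · exact hlone z hz.2.2 hzu h
      · exact hlone x hx hux h
      · exact hlone y hyB huy h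
  · push Not at hpair
    obtain ⟨x, hx⟩ := Finset.card_pos.1 (show 0 < B.card by omega)
    obtain ⟨y, hyB, hxy, hr₁, hr₂⟩ := hy x hx
    refine ⟨x, hx, y, hyB, hxy, hr₁, hr₂, fun _ => ?_⟩
    have hcard : ((B.erase x).erase y).card = B.card - 2 := by
      rw [Finset.card_erase_of_mem (by simp [hyB, hxy.symm]), Finset.card_erase_of_mem hx]
      omega
    obtain ⟨w, hw⟩ := Finset.card_pos.1 (show 0 < ((B.erase x).erase y).card by omega)
    refine ⟨w, hw, fun z hz hzw hreach => ?_⟩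
    simp only [Finset.mem_erase] at hw hz
    rcases reachable_insert hreach with h | ⟨h, -⟩ | ⟨h, -⟩
    · exact hpair w hw.2.2 z hz.2.2 (Ne.symm hzw) h
    · exact hpair w hw.2.2 x hx hw.2.1 h
    · exact hpair w hw.2.2 y hyB hw.1 h

/-- Link the leaves `B` of `F₁` by common additional edges of `F₁` and `F₂` until `F₁` becomes a
Hamiltonian path, keeping `F₂` a linear forest. -/
lemma LinForestE.exists_linking (hV : 3 ≤ Fintype.card V) (ℓ : Sym2 V → ℝ)
    {F₁ F₂ : Finset (Sym2 V)} {B : Finset V} (h₁ : LinForestE F₁) (h₂ : LinForestE F₂)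
    (hB₁ : ∀ v ∈ B, degE F₁ v = 1) (hB₁' : ∀ v ∉ B, degE F₁ v = 2)
    (hB₂ : ∀ v ∈ B, degE F₂ v ≤ 1) :
    ∃ F₁' F₂' a b, LinForestE F₁' ∧ LinForestE F₂' ∧ a ≠ b ∧ a ∈ B ∧ b ∈ B ∧
      (∀ v, degE F₁' v = if v = a ∨ v = b then 1 else 2) ∧ F₂ ⊆ F₂' ∧
      (∀ v, degE F₂' v = degE F₂ v + if v ∈ B ∧ v ≠ a ∧ v ≠ b then 1 else 0) ∧
      lenE ℓ F₁' + lenE ℓ F₂ = lenE ℓ F₁ + lenE ℓ F₂' ∧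
      (HasIsolatedIn F₂ B → ¬ (graphE F₂').Reachable a b) := by
  induction hn : B.card using Nat.strong_induction_on generalizing B F₁ F₂ with
  | _ n ih =>
  have : Nonempty V := Fintype.card_pos_iff.1 (by omega)
  have hcard := two_mul_card_add h₁.simple hB₁ hB₁'
  have hle := h₁.card_add_one_le
  rcases Nat.lt_or_ge B.card 4 with hlt | hge
  · obtain ⟨a, b, hab, rfl⟩ := Finset.card_eq_two.1 (show B.card = 2 by omega)
    refine ⟨F₁, F₂, a, b, h₁, h₂, hab, by simp, by simp, fun v => ?_, subset_rfl, fun v => ?_,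
      rfl, ?_⟩
    · split_ifs with hv
      · exact hB₁ v (by simpa using hv)
      · exact hB₁' v (by simpa using hv)
    · rw [if_neg (by simp; tauto), add_zero]
    · rintro ⟨u, hu, hlone⟩ hr
      simp only [Finset.mem_insert, Finset.mem_singleton] at hu
      rcases hu with rfl | rfl
      · exact hlone b (by simp) hab.symm hr
      · exact hlone a (by simp) hab hr.symm
  · obtain ⟨x, hx, y, hy, hxy, hr₁, hr₂, hiso⟩ :=
      h₁.exists_linkable_pair h₂ (fun v hv => (hB₁ v hv).le) hB₂ hge
    have hm₁ : s(x, y) ∉ F₁ := fun hm => hr₁ (reachable_of_mem hm)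
    have hm₂ : s(x, y) ∉ F₂ := fun hm => hr₂ (reachable_of_mem hm)
    obtain ⟨F₁', F₂', a, b, h₁', h₂', hab, ha, hb, hd₁, hsub, hd₂, hlen, hnr⟩ :=
      ih ((B.erase x).erase y).card
        (by rw [← hn]; exact (Finset.card_erase_le).trans_lt (Finset.card_erase_lt_of_mem hx))
        (h₁.insert_edge hxy (hB₁ x hx).le (hB₁ y hy).le hr₁)
        (h₂.insert_edge hxy (hB₂ x hx) (hB₂ y hy) hr₂)
        (B := (B.erase x).erase y)
        (fun v hv => by
          simp only [Finset.mem_erase] at hv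
          rw [degE_insert hm₁, hB₁ v hv.2.2, if_neg (by tauto)])
        (fun v hv => by
          simp only [Finset.mem_erase] at hv
          rw [degE_insert hm₁]
          by_cases hvB : v ∈ B
          · rw [hB₁ v hvB, if_pos (by tauto)]
          · rw [hB₁' v hvB, if_neg (by rintro (rfl | rfl) <;> exact hvB ‹_›)])
        (fun v hv => by
          simp only [Finset.mem_erase] at hv
          rw [degE_insert hm₂, if_neg (by tauto)]
          exact hB₂ v hv.2.2) rfl
    simp only [Finset.mem_erase] at ha hb
    refine ⟨F₁', F₂', a, b, h₁', h₂', hab, ha.2.2, hb.2.2, hd₁,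
      (Finset.subset_insert _ _).trans hsub, fun v => ?_, ?_, fun h => hnr (hiso h)⟩
    · rw [hd₂, degE_insert hm₂]
      simp only [Finset.mem_erase]
      by_cases hv : v = x ∨ v = y
      · have hvB : v ∈ B := by rcases hv with rfl | rfl <;> assumption
        have hva : v ≠ a := by rintro rfl; tauto
        have hvb : v ≠ b := by rintro rfl; tauto
        rw [if_pos hv, if_neg (by tauto), if_pos ⟨hvB, hva, hvb⟩]
      · rw [if_neg hv, add_zero]
        congr 2
        simp only [eq_iff_iff]
        tauto
    · simp only [lenE, Finset.sum_insert hm₁, Finset.sum_insert hm₂] at hlen ⊢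
      linarith

lemma lenE_le_lenE_insert {ℓ : Sym2 V → ℝ} (hℓ : ∀ e, 0 ≤ ℓ e) (F : Finset (Sym2 V))
    (e : Sym2 V) : lenE ℓ (insert e F) ≤ lenE ℓ F + ℓ e := by
  unfold lenE
  by_cases h : e ∈ F
  · rw [Finset.insert_eq_of_mem h]; linarith [hℓ e]
  · rw [Finset.sum_insert h]; linarith

/-- Complete the linear forest `F₁` with leaves `B` to a tour, at the cost of adding edges to `F₂`
that raise the degree of every vertex of `B` by one. -/
lemma LinForestE.exists_tour (hV : 3 ≤ Fintype.card V) {ℓ : Sym2 V → ℝ} (hℓ : ∀ e, 0 ≤ ℓ e)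
    {F₁ F₂ : Finset (Sym2 V)} {B : Finset V} (h₁ : LinForestE F₁) (h₂ : LinForestE F₂)
    (hB₁ : ∀ v ∈ B, degE F₁ v = 1) (hB₁' : ∀ v ∉ B, degE F₁ v = 2)
    (hB₂ : ∀ v ∈ B, degE F₂ v ≤ 1) (hiso : HasIsolatedIn F₂ B) :
    ∃ K F, IsTourE K ∧ LinForestE F ∧ F₂ ⊆ F ∧
      (∀ v, degE F v = degE F₂ v + if v ∈ B then 1 else 0) ∧
      lenE ℓ K + lenE ℓ F₂ ≤ lenE ℓ F₁ + lenE ℓ F := by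
  obtain ⟨F₁', F₂', a, b, h₁', h₂', hab, ha, hb, hd₁, hsub, hd₂, hlen, hnr⟩ :=
    h₁.exists_linking hV ℓ h₂ hB₁ hB₁' hB₂
  have hr := hnr hiso
  have hm : s(a, b) ∉ F₂' := fun hm => hr (reachable_of_mem hm)
  refine ⟨insert s(a, b) F₁', insert s(a, b) F₂', h₁'.isTourE_insert hV hab hd₁,
    h₂'.insert_edge hab ?_ ?_ hr, hsub.trans (Finset.subset_insert _ _), fun v => ?_, ?_⟩
  · rw [hd₂]; simpa using hB₂ a ha
  · rw [hd₂]; simpa using hB₂ b hb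
  · rw [degE_insert hm, hd₂]
    by_cases hv : v = a ∨ v = b
    · have hvB : v ∈ B := by rcases hv with rfl | rfl <;> assumption
      rw [if_pos hv, if_pos hvB, if_neg (by tauto), add_zero]
    · rw [if_neg hv, add_zero]
      congr 2
      simp only [eq_iff_iff]
      tauto
  · have := lenE_le_lenE_insert hℓ F₁' s(a, b)
    have h2 : lenE ℓ (insert s(a, b) F₂') = ℓ s(a, b) + lenE ℓ F₂' := Finset.sum_insert hm
    linarith

/-- Two linear forests with the same leaves are completed to tours by the same edges. -/
lemma LinForestE.exists_two_tours (hV : 3 ≤ Fintype.card V) {ℓ : Sym2 V → ℝ}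
    (hℓ : ∀ e, 0 ≤ ℓ e) {F₁ F₂ : Finset (Sym2 V)} {B : Finset V} (h₁ : LinForestE F₁)
    (h₂ : LinForestE F₂) (hB₁ : ∀ v ∈ B, degE F₁ v = 1) (hB₁' : ∀ v ∉ B, degE F₁ v = 2)
    (hB₂ : ∀ v ∈ B, degE F₂ v = 1) (hB₂' : ∀ v ∉ B, degE F₂ v = 2) :
    ∃ K H, IsTourE K ∧ IsTourE H ∧ lenE ℓ K + lenE ℓ F₂ ≤ lenE ℓ F₁ + lenE ℓ H := by
  obtain ⟨F₁', F₂', a, b, h₁', h₂', hab, ha, hb, hd₁, hsub, hd₂, hlen, -⟩ :=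
    h₁.exists_linking hV ℓ h₂ hB₁ hB₁' fun v hv => (hB₂ v hv).le
  have hd₂' : ∀ v, degE F₂' v = if v = a ∨ v = b then 1 else 2 := by
    intro v
    rw [hd₂]
    by_cases hv : v = a ∨ v = b
    · have hvB : v ∈ B := by rcases hv with rfl | rfl <;> assumption
      rw [if_pos hv, hB₂ v hvB, if_neg (by tauto)]
    · rw [if_neg hv]
      by_cases hvB : v ∈ B
      · rw [hB₂ v hvB, if_pos (by tauto)]
      · rw [hB₂' v hvB, if_neg (by tauto)]
  have htour := h₂'.isTourE_insert hV hab hd₂'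
  have hm : s(a, b) ∉ F₂' := by
    intro hm
    rw [Finset.insert_eq_of_mem hm] at htour
    obtain ⟨x, y, hxy, -, -, hx, hy⟩ := htour.1.exists_neighbors (v := a) (by rw [htour.2]; trivial)
    have := two_le_degE hx hy hxy
    rw [hd₂'] at this
    simp at this
  refine ⟨_, _, h₁'.isTourE_insert hV hab hd₁, htour, ?_⟩
  have := lenE_le_lenE_insert hℓ F₁' s(a, b)
  have h2 : lenE ℓ (insert s(a, b) F₂') = ℓ s(a, b) + lenE ℓ F₂' := Finset.sum_insert hm
  linarith

lemma notMem_of_degE_eq_zero {F : Finset (Sym2 V)} {y : V} (h : degE F y = 0) (x : V) :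
    s(x, y) ∉ F := by
  intro hm
  rw [Sym2.eq_swap] at hm
  have := one_le_degE hm
  omega

lemma eq_of_reachable_of_degE_eq_zero {F : Finset (Sym2 V)} {u v : V} (h : degE F u = 0)
    (hr : (graphE F).Reachable u v) : v = u := by
  refine mem_of_reachable (A := {u}) (fun x hx y hxy => ?_) rfl hr
  obtain rfl : x = u := hx
  have hm : s(x, y) ∈ F := by simpa using (SimpleGraph.fromEdgeSet_adj _ |>.1 hxy).1
  have := one_le_degE hm
  omega

lemma LinForestE.insert_pendant {F : Finset (Sym2 V)} (hF : LinForestE F) {x y : V}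
    (hxy : x ≠ y) (hx : degE F x ≤ 1) (hy : degE F y = 0) : LinForestE (insert s(x, y) F) :=
  hF.insert_edge hxy hx (by omega)
    fun h => hxy (eq_of_reachable_of_degE_eq_zero hy h.symm)

lemma linForestE_empty : LinForestE (∅ : Finset (Sym2 V)) :=
  ⟨fun e he => by simp at he, fun v => by simp [degE], by
    rw [graphE, Finset.coe_empty, SimpleGraph.fromEdgeSet_empty]
    exact SimpleGraph.isAcyclic_bot⟩

lemma IsCycleE.exists_mem_VsetE {C : Finset (Sym2 V)} (hC : IsCycleE C) : ∃ v, v ∈ VsetE C := by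
  obtain ⟨m, hm, f, -, rfl⟩ := hC
  exact ⟨f 0, s(f 0, f ((0 + 1) % m)),
    Finset.mem_image_of_mem (fun i => s(f i, f ((i + 1) % m))) (Finset.mem_range.2 (by omega)),
    Sym2.mem_mk_left _ _⟩

/-- A cycle all of whose vertices are leaves or isolated in a linear forest `T` has an edge, other
than a prescribed one, joining distinct components of `T`. -/
lemma IsCycleE.exists_edge_not_reachable {C T : Finset (Sym2 V)} (hC : IsCycleE C)
    (hT : LinForestE T) (hd : ∀ v ∈ VsetE C, degE T v ≤ 1) (e : Sym2 V) :
    ∃ x y, x ≠ y ∧ s(x, y) ∈ C ∧ s(x, y) ≠ e ∧ ¬ (graphE T).Reachable x y := by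
  obtain ⟨r, hr, hre⟩ : ∃ r ∈ VsetE C, r ∉ e := by
    obtain ⟨v, hv⟩ := hC.exists_mem_VsetE
    obtain ⟨x, y, hxy, hxv, hyv, hx, hy⟩ := hC.exists_neighbors hv
    by_contra! hall
    have h1 := hall v hv
    have h2 := hall x ⟨_, hx, Sym2.mem_mk_right _ _⟩
    have h3 := hall y ⟨_, hy, Sym2.mem_mk_right _ _⟩
    rw [(Sym2.mem_and_mem_iff hxy).1 ⟨h2, h3⟩, Sym2.mem_iff] at h1
    tauto
  obtain ⟨x, y, hxy, hxr, hyr, hx, hy⟩ := hC.exists_neighbors hr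
  have hne : ∀ z, s(r, z) ≠ e := fun z h => hre (h ▸ Sym2.mem_mk_left _ _)
  by_contra! hall
  exact not_three_leaves hT.simple hT.deg_le hxr.symm hyr.symm hxy (hd r hr)
    (hd x ⟨_, hx, Sym2.mem_mk_right _ _⟩) (hd y ⟨_, hy, Sym2.mem_mk_right _ _⟩)
    (hall r x hxr.symm hx (hne x)) (hall r y hyr.symm hy (hne y))

/-- Move one edge of every cycle of `S` to the linear forest `T`. -/
lemma exists_linForestE_exchange (ℓ : Sym2 V → ℝ) {S T : Finset (Sym2 V)} (hS : SimpleE S)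
    (hd : ∀ v, degE S v ≤ 2) (hT : LinForestE T)
    (h : ∀ C ⊆ S, IsCycleE C → ∀ v ∈ VsetE C, degE S v + degE T v ≤ 3) :
    ∃ S₁ T₁, S₁ ⊆ S ∧ LinForestE S₁ ∧ LinForestE T₁ ∧
      (∀ v, degE S₁ v + degE T₁ v = degE S v + degE T v) ∧
      lenE ℓ S₁ + lenE ℓ T₁ = lenE ℓ S + lenE ℓ T ∧
      ∀ e ∈ S, (∀ C ⊆ S, IsCycleE C → e ∉ C) → e ∈ S₁ := by
  induction hn : S.card using Nat.strong_induction_on generalizing S T with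
  | _ n ih =>
  by_cases hlin : LinForestE S
  · exact ⟨S, T, subset_rfl, hlin, hT, fun _ => rfl, rfl, fun e he _ => he⟩
  obtain ⟨C, hCS, hC⟩ := exists_isCycleE_of_not_linForestE hS hd hlin
  have hdT : ∀ v ∈ VsetE C, degE T v ≤ 1 := by
    intro v hv
    obtain ⟨x, y, hxy, -, -, hx, hy⟩ := hC.exists_neighbors hv
    have := two_le_degE (hCS hx) (hCS hy) hxy
    have := h C hCS hC v hv
    omega
  obtain ⟨z, -⟩ := hC.exists_mem_VsetE
  obtain ⟨x, y, hxy, hxyC, -, hr⟩ := hC.exists_edge_not_reachable hT hdT s(z, z)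
  have hmS := hCS hxyC
  have hmT : s(x, y) ∉ T := fun hm => hr (reachable_of_mem hm)
  have hsum : ∀ v, degE (S.erase s(x, y)) v + degE (insert s(x, y) T) v
      = degE S v + degE T v := by
    intro v
    rw [degE_insert hmT, ← degE_erase hmS v]; omega
  have hsub := Finset.erase_subset s(x, y) S
  obtain ⟨S₁, T₁, hS₁, hl, hl', hdeg, hlen, hkeep⟩ := ih (S.erase s(x, y)).card
    (by rw [← hn]; exact Finset.card_erase_lt_of_mem hmS)
    (fun e he => hS e (hsub he)) (fun v => (degE_mono hsub v).trans (hd v))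
    (hT.insert_edge hxy (hdT x ⟨_, hxyC, Sym2.mem_mk_left _ _⟩)
      (hdT y ⟨_, hxyC, Sym2.mem_mk_right _ _⟩) hr)
    (fun D hD hDc v hv => by rw [hsum]; exact h D (hD.trans hsub) hDc v hv) rfl
  refine ⟨S₁, T₁, hS₁.trans hsub, hl, hl', fun v => by rw [hdeg, hsum], ?_, fun e he hcyc => ?_⟩
  · rw [hlen]
    have h1 : lenE ℓ (insert s(x, y) T) = ℓ s(x, y) + lenE ℓ T := Finset.sum_insert hmT
    have h2 : lenE ℓ (S.erase s(x, y)) + ℓ s(x, y) = lenE ℓ S := Finset.sum_erase_add _ _ hmS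
    linarith
  · refine hkeep e (Finset.mem_erase.2 ⟨?_, he⟩) fun D hD hDc => hcyc D (hD.trans hsub) hDc
    rintro rfl
    exact hcyc C hCS hC hxyC

/-- From a 2-factor `S` containing distinct cycles `D ∋ s(p, q)` and `C`, and a linear forest `T`
with a path `a, w, p`, remove `s(p, q)` and an edge of `C` from `S` and exchange further edges
between `S` and `T` so that both become linear forests. -/
lemma exists_linForestE_pair (ℓ : Sym2 V → ℝ) {S T C D : Finset (Sym2 V)} (hS : SimpleE S)
    (hd : ∀ v, degE S v = 2) (hC : IsCycleE C) (hCS : C ⊆ S) (hD : IsCycleE D) (hDS : D ⊆ S)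
    (hCD : C ≠ D) (hT : LinForestE T) {a w p q : V} (hpq : s(p, q) ∈ D) (hw : w ∈ VsetE D)
    (haw : s(a, w) ∈ T) (hwp : s(w, p) ∈ T) (hap : a ≠ p) (haq : a ≠ q) (hwa : a ≠ w)
    (hwp' : w ≠ p) (hwq : w ≠ q) (hdT : ∀ v, degE T v = if v = w then 2 else 1) (e : Sym2 V) :
    ∃ x y S₁ T₁, s(x, y) ∈ C ∧ s(x, y) ≠ e ∧ x ≠ y ∧ S₁ ⊆ S ∧ LinForestE S₁ ∧ LinForestE T₁ ∧
      (∀ v, degE S₁ v + degE T₁ v = if v = w then 4 else 3) ∧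
      lenE ℓ S₁ + lenE ℓ T₁ = lenE ℓ S + lenE ℓ T ∧
      ∀ v, v ∈ VsetE C ∨ v ∈ VsetE D →
        degE S₁ v = if v = p ∨ v = q ∨ v = x ∨ v = y then 1 else 2 := by
  have hd' : ∀ v, degE S v ≤ 2 := fun v => (hd v).le
  have hpqne := hS.ne (hDS hpq)
  have hpD : p ∈ VsetE D := ⟨_, hpq, Sym2.mem_mk_left _ _⟩
  have hqD : q ∈ VsetE D := ⟨_, hpq, Sym2.mem_mk_right _ _⟩
  have hdisj : ∀ v ∈ VsetE C, v ∉ VsetE D := fun v hvC hvD =>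
    hCD (hC.eq_of_mem hCS hD hDS hd' hvC hvD)
  have hrT : ¬ (graphE T).Reachable p q := by
    refine not_three_leaves hT.simple hT.deg_le hap.symm hpqne haq ?_ ?_ ?_
      ((reachable_of_mem haw).trans (reachable_of_mem hwp)).symm
    · rw [hdT, if_neg hwp'.symm]
    · rw [hdT, if_neg hwa]
    · rw [hdT, if_neg hwq.symm]
  have hmT : s(p, q) ∉ T := fun hm => hrT (reachable_of_mem hm)
  have hT₂ := hT.insert_edge hpqne (by rw [hdT, if_neg hwp'.symm]) (by rw [hdT, if_neg hwq.symm])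
    hrT
  have hdT₂ : ∀ v, v ≠ p → v ≠ q → v ≠ w → degE (insert s(p, q) T) v = 1 := by
    intro v hvp hvq hvw
    rw [degE_insert hmT, hdT, if_neg hvw, if_neg (by tauto)]
  have hdC : ∀ v ∈ VsetE C, degE (insert s(p, q) T) v = 1 := fun v hv =>
    hdT₂ v (fun h => hdisj v hv (h ▸ hpD)) (fun h => hdisj v hv (h ▸ hqD))
      (fun h => hdisj v hv (h ▸ hw))
  obtain ⟨x, y, hxy, hxyC, hxye, hr⟩ :=
    hC.exists_edge_not_reachable hT₂ (fun v hv => (hdC v hv).le) e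
  have hxC : x ∈ VsetE C := ⟨_, hxyC, Sym2.mem_mk_left _ _⟩
  have hyC : y ∈ VsetE C := ⟨_, hxyC, Sym2.mem_mk_right _ _⟩
  have hmT₂ : s(x, y) ∉ insert s(p, q) T := fun hm => hr (reachable_of_mem hm)
  have hT₃ := hT₂.insert_edge hxy (hdC x hxC).le (hdC y hyC).le hr
  have hne : s(x, y) ≠ s(p, q) := fun h => hmT₂ (h ▸ Finset.mem_insert_self _ _)
  have hmS : s(x, y) ∈ S.erase s(p, q) := Finset.mem_erase.2 ⟨hne, hCS hxyC⟩
  set S₂ := (S.erase s(p, q)).erase s(x, y) with hS₂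
  set T₂ := insert s(x, y) (insert s(p, q) T) with hT₂def
  have hsub : S₂ ⊆ S := (Finset.erase_subset _ _).trans (Finset.erase_subset _ _)
  have hdS₂ : ∀ v, degE S₂ v + (if v = x ∨ v = y then 1 else 0) +
      (if v = p ∨ v = q then 1 else 0) = 2 := by
    intro v
    rw [degE_erase hmS, degE_erase (hDS hpq), hd]
  have hcyc : ∀ E ⊆ S₂, IsCycleE E → ∀ v ∈ VsetE E, v ∉ VsetE C ∧ v ∉ VsetE D := by
    intro E hE hEc v hv
    constructor <;> intro hv'
    · rw [← hEc.eq_of_mem (hE.trans hsub) hC hCS hd' hv hv'] at hxyC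
      simpa [hS₂] using hE hxyC
    · rw [← hEc.eq_of_mem (hE.trans hsub) hD hDS hd' hv hv'] at hpq
      simpa [hS₂] using hE hpq
  have hsum : ∀ v, degE S₂ v + degE T₂ v = if v = w then 4 else 3 := by
    intro v
    have := hdS₂ v
    rw [degE_insert hmT₂, degE_insert hmT, hdT]
    split_ifs at this ⊢ <;> omega
  obtain ⟨S₁, T₁, hS₁, hl, hl', hdeg, hlen, hkeep⟩ := exists_linForestE_exchange ℓ
    (fun e he => hS e (hsub he)) (fun v => (degE_mono hsub v).trans (hd' v)) hT₃ (by
      intro E hE hEc v hv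
      have := (hcyc E hE hEc v hv).2
      rw [hsum, if_neg (by rintro rfl; exact this hw)])
  refine ⟨x, y, S₁, T₁, hxyC, hxye, hxy, hS₁.trans hsub, hl, hl', fun v => (hdeg v).trans (hsum v),
    hlen.trans ?_, fun v hv => ?_⟩
  · have h1 : lenE ℓ T₂ = ℓ s(x, y) + lenE ℓ (insert s(p, q) T) := Finset.sum_insert hmT₂
    have h2 : lenE ℓ (insert s(p, q) T) = ℓ s(p, q) + lenE ℓ T := Finset.sum_insert hmT
    have h3 : lenE ℓ S₂ + ℓ s(x, y) = lenE ℓ (S.erase s(p, q)) := Finset.sum_erase_add _ _ hmS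
    have h4 : lenE ℓ (S.erase s(p, q)) + ℓ s(p, q) = lenE ℓ S :=
      Finset.sum_erase_add _ _ (hDS hpq)
    linarith
  · have heq : degE S₁ v = degE S₂ v := by
      refine (degE_mono hS₁ v).antisymm (Finset.card_le_card fun e he => ?_)
      rw [Finset.mem_filter] at he ⊢
      refine ⟨hkeep e he.1 fun E hE hEc heE => ?_, he.2⟩
      have := hcyc E hE hEc v ⟨e, heE, he.2⟩
      tauto
    have hxp : v = x ∨ v = y → ¬ (v = p ∨ v = q) := by
      rintro (rfl | rfl) (h | h)
      · exact hdisj _ hxC (h ▸ hpD)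
      · exact hdisj _ hxC (h ▸ hqD)
      · exact hdisj _ hyC (h ▸ hpD)
      · exact hdisj _ hyC (h ▸ hqD)
    have := hdS₂ v
    rw [heq]
    by_cases h1 : v = x ∨ v = y
    · rw [if_pos h1, if_neg (hxp h1)] at this
      rw [if_pos (by tauto)]; omega
    · by_cases h2 : v = p ∨ v = q
      · rw [if_neg h1, if_pos h2] at this
        rw [if_pos (by tauto)]; omega
      · rw [if_neg h1, if_neg h2] at this
        rw [if_neg (by tauto)]; omega

lemma exists_linForestE_path (ℓ : Sym2 V → ℝ) {a b c d : V} (hab : a ≠ b) (hbc : b ≠ c)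
    (hac : a ≠ c) (had : a ≠ d) (hbd : b ≠ d) (hcd : c ≠ d) :
    ∃ R, LinForestE R ∧ degE R a = 2 ∧ degE R b = 2 ∧ degE R c = 1 ∧ degE R d = 1 ∧
      (∀ v, v ≠ a → v ≠ b → v ≠ c → v ≠ d → degE R v = 0) ∧ (graphE R).Reachable d c ∧
      lenE ℓ R = ℓ s(a, d) + ℓ s(b, c) + ℓ s(a, b) := by
  have h0 : ∀ v, degE (∅ : Finset (Sym2 V)) v = 0 := fun v => by simp [degE]
  have hP := linForestE_empty.insert_pendant hab (by simp [h0]) (h0 b)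
  have hdP := degE_insert (notMem_of_degE_eq_zero (h0 b) a)
  rw [insert_empty_eq] at hP
  simp only [insert_empty_eq] at hdP
  have hPc : degE {s(a, b)} c = 0 := by simp [hdP, h0, hac.symm, hbc.symm]
  have hQ := hP.insert_pendant hbc (by simp [hdP, h0]) hPc
  have hmQ := notMem_of_degE_eq_zero hPc b
  have hdQ := degE_insert hmQ
  have hQd : degE (insert s(b, c) {s(a, b)}) d = 0 := by
    simp [hdQ, hdP, h0, had.symm, hbd.symm, hcd.symm]
  have hmR := notMem_of_degE_eq_zero hQd a
  have hdR := degE_insert hmR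
  refine ⟨insert s(a, d) (insert s(b, c) {s(a, b)}),
    hQ.insert_pendant had (by simp [hdQ, hdP, h0, hab, hac]) hQd, ?_, ?_, ?_, ?_, ?_, ?_, ?_⟩
  · simp [hdR, hdQ, hdP, h0, hab, hac]
  · simp [hdR, hdQ, hdP, h0, hab.symm, hbd]
  · simp [hdR, hdQ, hdP, h0, hac.symm, hbc.symm, hcd]
  · simp [hdR, hdQ, hdP, h0, had.symm, hbd.symm, hcd.symm]
  · intro v ha hb hc hd
    simp [hdR, hdQ, hdP, h0, ha, hb, hc, hd]
  · have h1 := reachable_of_mem (F := insert s(a, d) (insert s(b, c) {s(a, b)}))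
      (x := a) (y := d) (by simp)
    have h2 := reachable_of_mem (F := insert s(a, d) (insert s(b, c) {s(a, b)}))
      (x := a) (y := b) (by simp)
    have h3 := reachable_of_mem (F := insert s(a, d) (insert s(b, c) {s(a, b)}))
      (x := b) (y := c) (by simp)
    exact h1.symm.trans (h2.trans h3)
  · unfold lenE
    rw [Finset.sum_insert hmR, Finset.sum_insert hmQ]
    simp [add_assoc]

set_option maxHeartbeats 400000 in
lemma exists_four_tours (hV : 3 ≤ Fintype.card V) {ℓ : Sym2 V → ℝ} (hℓ : ∀ e, 0 ≤ ℓ e)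
    {S₁ S₂ T₁ T₂ : Finset (Sym2 V)} (hS₁ : LinForestE S₁) (hS₂ : LinForestE S₂)
    (hT₁ : LinForestE T₁) (hT₂ : LinForestE T₂) {v₁ v₂ v₃ v₄ t₁ t₂ : V}
    (hv₁₂ : v₁ ≠ v₂) (hv₁₃ : v₁ ≠ v₃) (hv₂₃ : v₂ ≠ v₃) (hv₃₄ : v₃ ≠ v₄) (hv₂₄ : v₂ ≠ v₄)
    (hvt₁ : v₁ ≠ t₂) (hvt₄ : v₄ ≠ t₁)
    (hd₁ : ∀ v, degE S₁ v + degE T₁ v = if v = v₂ then 4 else 3)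
    (hd₂ : ∀ v, degE S₂ v + degE T₂ v = if v = v₃ then 4 else 3)
    (h₁v₁ : degE S₁ v₁ = 2) (h₁v₂ : degE S₁ v₂ = 2) (h₁v₃ : degE S₁ v₃ = 1)
    (h₁v₄ : degE S₁ v₄ = 1) (h₁t₁ : degE S₁ t₁ = 1) (h₁t₂ : degE S₁ t₂ = 2)
    (h₂v₁ : degE S₂ v₁ = 1) (h₂v₂ : degE S₂ v₂ = 1) (h₂v₃ : degE S₂ v₃ = 2)
    (h₂t₁ : degE S₂ t₁ = 2) (h₂t₂ : degE S₂ t₂ = 1)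
    (ht₁ : ¬ (graphE S₁).Reachable v₃ t₁) (ht₂ : ¬ (graphE S₂).Reachable v₂ t₂) :
    ∃ K₁ K₂ K₃ K₄ H, IsTourE K₁ ∧ IsTourE K₂ ∧ IsTourE K₃ ∧ IsTourE K₄ ∧ IsTourE H ∧
      lenE ℓ K₁ + lenE ℓ K₂ + lenE ℓ K₃ + lenE ℓ K₄ + ℓ s(v₂, v₃) ≤
        lenE ℓ S₁ + lenE ℓ T₁ + lenE ℓ S₂ + lenE ℓ T₂ + lenE ℓ H := by
  have ht₁v₃ : v₃ ≠ t₁ := by rintro rfl; exact ht₁ .rfl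
  have ht₂v₂ : v₂ ≠ t₂ := by rintro rfl; exact ht₂ .rfl
  have ht₁v₂ : v₂ ≠ t₁ := by rintro rfl; omega
  have ht₂v₃ : v₃ ≠ t₂ := by rintro rfl; omega
  have ht₁₂ : t₁ ≠ t₂ := by rintro rfl; omega
  have ht₁v₁ : v₁ ≠ t₁ := by rintro rfl; omega
  have hrange₁ : ∀ v, v ≠ v₂ →
      (degE S₁ v = 1 ∧ degE T₁ v = 2) ∨ (degE S₁ v = 2 ∧ degE T₁ v = 1) := by
    intro v hv
    have h1 := hd₁ v
    have h2 := hS₁.deg_le v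
    have h3 := hT₁.deg_le v
    rw [if_neg hv] at h1
    omega
  have hrange₂ : ∀ v, v ≠ v₃ →
      (degE S₂ v = 1 ∧ degE T₂ v = 2) ∨ (degE S₂ v = 2 ∧ degE T₂ v = 1) := by
    intro v hv
    have h1 := hd₂ v
    have h2 := hS₂.deg_le v
    have h3 := hT₂.deg_le v
    rw [if_neg hv] at h1
    omega
  have hTv₂ : degE T₁ v₂ = 2 := by have := hd₁ v₂; rw [if_pos rfl] at this; omega
  have hTv₃ : degE T₂ v₃ = 2 := by have := hd₂ v₃; rw [if_pos rfl] at this; omega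
  obtain ⟨R, hR, hRv₂, hRv₃, hRt₁, hRt₂, hR0, hrR, hlR⟩ :=
    exists_linForestE_path ℓ hv₂₃ ht₁v₃ ht₁v₂ ht₂v₂ ht₂v₃ ht₁₂
  -- first tour
  have hm₁ : s(v₃, t₁) ∉ S₁ := fun hm => ht₁ (reachable_of_mem hm)
  have hF₁ := hS₁.insert_edge ht₁v₃ h₁v₃.le h₁t₁.le ht₁
  have hdF₁ := degE_insert hm₁
  have hlF₁ : lenE ℓ (insert s(v₃, t₁) S₁) = ℓ s(v₃, t₁) + lenE ℓ S₁ := Finset.sum_insert hm₁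
  set A₁ := Finset.univ.filter fun v => degE S₁ v = 1 ∧ v ≠ v₃ ∧ v ≠ t₁ with hA₁
  have hA₁0 : ∀ v ∈ A₁, degE R v = 0 := by
    intro v hv
    simp only [hA₁, Finset.mem_filter, Finset.mem_univ, true_and] at hv
    exact hR0 v (by rintro rfl; omega) hv.2.1 hv.2.2 (by rintro rfl; omega)
  have hv₄A : v₄ ∈ A₁ := by simp [hA₁, h₁v₄, hv₃₄.symm, hvt₄]
  obtain ⟨K₁, G₁, hK₁, hG₁, hRG₁, hdG₁, hlen₁⟩ := hF₁.exists_tour hV hℓ hR (B := A₁)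
    (fun v hv => by
      simp only [hA₁, Finset.mem_filter, Finset.mem_univ, true_and] at hv
      rw [hdF₁, hv.1, if_neg (by tauto)])
    (fun v hv => by
      simp only [hA₁, Finset.mem_filter, Finset.mem_univ, true_and] at hv
      rw [hdF₁]
      by_cases h : v = v₃ ∨ v = t₁
      · rw [if_pos h]; rcases h with rfl | rfl <;> omega
      · rw [if_neg h]
        by_cases h2 : v = v₂
        · rw [h2, h₁v₂]
        · rcases hrange₁ v h2 with h3 | h3
          · exact absurd ⟨h3.1, by tauto⟩ hv
          · omega)
    (fun v hv => by rw [hA₁0 v hv]; omega)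
    ⟨v₄, hv₄A, fun x _ hx hr => hx (eq_of_reachable_of_degE_eq_zero (hA₁0 _ hv₄A) hr)⟩
  -- second tour
  have hm₂ : s(v₂, t₂) ∉ S₂ := fun hm => ht₂ (reachable_of_mem hm)
  have hF₂ := hS₂.insert_edge ht₂v₂ h₂v₂.le h₂t₂.le ht₂
  have hdF₂ := degE_insert hm₂
  have hlF₂ : lenE ℓ (insert s(v₂, t₂) S₂) = ℓ s(v₂, t₂) + lenE ℓ S₂ := Finset.sum_insert hm₂
  set A₂ := Finset.univ.filter fun v => degE S₂ v = 1 ∧ v ≠ v₂ ∧ v ≠ t₂ with hA₂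
  have hA₂0 : ∀ v ∈ A₂, degE R v = 0 := by
    intro v hv
    simp only [hA₂, Finset.mem_filter, Finset.mem_univ, true_and] at hv
    exact hR0 v hv.2.1 (by rintro rfl; omega) (by rintro rfl; omega) hv.2.2
  have hv₁A : v₁ ∈ A₂ := by simp [hA₂, h₂v₁, hv₁₂, hvt₁]
  have hv₁G : degE G₁ v₁ = 0 := by
    rw [hdG₁, hA₂0 v₁ hv₁A, if_neg (by simp [hA₁, h₁v₁])]
  obtain ⟨K₂, G₂, hK₂, hG₂, hRG₂, hdG₂, hlen₂⟩ := hF₂.exists_tour hV hℓ hG₁ (B := A₂)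
    (fun v hv => by
      simp only [hA₂, Finset.mem_filter, Finset.mem_univ, true_and] at hv
      rw [hdF₂, hv.1, if_neg (by tauto)])
    (fun v hv => by
      simp only [hA₂, Finset.mem_filter, Finset.mem_univ, true_and] at hv
      rw [hdF₂]
      by_cases h : v = v₂ ∨ v = t₂
      · rw [if_pos h]; rcases h with rfl | rfl <;> omega
      · rw [if_neg h]
        by_cases h2 : v = v₃
        · rw [h2, h₂v₃]
        · rcases hrange₂ v h2 with h3 | h3
          · exact absurd ⟨h3.1, by tauto⟩ hv
          · omega)
    (fun v hv => by rw [hdG₁, hA₂0 v hv]; split_ifs <;> omega)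
    ⟨v₁, hv₁A, fun x _ hx hr => hx (eq_of_reachable_of_degE_eq_zero hv₁G hr)⟩
  replace hdG₂ : ∀ v, degE G₂ v = degE R v +
      (if degE S₁ v = 1 ∧ v ≠ v₃ ∧ v ≠ t₁ then 1 else 0) +
      (if degE S₂ v = 1 ∧ v ≠ v₂ ∧ v ≠ t₂ then 1 else 0) := fun v => by
    rw [hdG₂, hdG₁]; simp [hA₁, hA₂]
  have hGt₁ : degE G₂ t₁ = 1 := by rw [hdG₂, hRt₁, if_neg (by tauto), if_neg (by omega)]
  have hGt₂ : degE G₂ t₂ = 1 := by rw [hdG₂, hRt₂, if_neg (by omega), if_neg (by tauto)]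
  have hGv₂ : degE G₂ v₂ = 2 := by rw [hdG₂, hRv₂, if_neg (by omega), if_neg (by tauto)]
  have hGv₃ : degE G₂ v₃ = 2 := by rw [hdG₂, hRv₃, if_neg (by tauto), if_neg (by omega)]
  -- third tour
  set B := Finset.univ.filter fun v => degE T₁ v = 1 with hB
  have hTt₁ : degE T₁ t₁ = 2 := by have := hrange₁ t₁ ht₁v₂.symm; omega
  have hTt₂ : degE T₁ t₂ = 1 := by have := hrange₁ t₂ ht₂v₂.symm; omega
  have hTv₃' : degE T₁ v₃ = 2 := by have := hrange₁ v₃ hv₂₃.symm; omega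
  have hGB : ∀ v ∈ B, degE G₂ v ≤ 1 := by
    intro v hv
    simp only [hB, Finset.mem_filter, Finset.mem_univ, true_and] at hv
    have h1 : v ≠ v₂ := by rintro rfl; omega
    have h2 : v ≠ v₃ := by rintro rfl; omega
    have h3 : v ≠ t₁ := by rintro rfl; omega
    by_cases h4 : v = t₂
    · rw [h4, hGt₂]
    · have := hrange₁ v h1
      rw [hdG₂, hR0 v h1 h2 h3 h4, if_neg (by omega)]
      split_ifs <;> omega
  obtain ⟨K₃, G₃, hK₃, hG₃, -, hdG₃, hlen₃⟩ := hT₁.exists_tour hV hℓ hG₂ (B := B)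
    (fun v hv => by simpa [hB] using hv)
    (fun v hv => by
      simp only [hB, Finset.mem_filter, Finset.mem_univ, true_and] at hv
      by_cases h : v = v₂
      · rw [h, hTv₂]
      · have := hrange₁ v h; omega)
    hGB
    ⟨t₂, by simp [hB, hTt₂], fun x hx hxt => by
      have hxt₁ : t₁ ≠ x := by
        rintro rfl
        simp [hB, hTt₁] at hx
      exact not_three_leaves hG₂.simple hG₂.deg_le ht₁₂.symm hxt.symm hxt₁ hGt₂.le hGt₁.le
        (hGB x hx) (hrR.mono (graphE_mono (hRG₁.trans hRG₂)))⟩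
  replace hdG₃ : ∀ v, degE G₃ v = degE G₂ v + if degE T₁ v = 1 then 1 else 0 := fun v => by
    rw [hdG₃]; simp [hB]
  -- fourth tour
  have hfinal : ∀ v, degE G₃ v = degE T₂ v := by
    intro v
    rw [hdG₃]
    by_cases h1 : v = v₂
    · subst h1
      have := hrange₂ v hv₂₃
      rw [hGv₂, if_neg (by omega)]; omega
    by_cases h2 : v = v₃
    · subst h2
      rw [hGv₃, if_neg (by omega)]; omega
    have h5 := hrange₁ v h1
    have h6 := hrange₂ v h2
    by_cases h3 : v = t₁
    · subst h3
      rw [hGt₁, if_neg (by omega)]; omega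
    by_cases h4 : v = t₂
    · subst h4
      rw [hGt₂, if_pos (by omega)]; omega
    rw [hdG₂, hR0 v h1 h2 h3 h4]
    simp only [h1, h2, h3, h4, ne_eq, not_false_eq_true, and_true]
    split_ifs <;> omega
  have hT₂' : ∀ v, degE T₂ v ≠ 1 → degE T₂ v = 2 := fun v hv => by
    by_cases h : v = v₃
    · rw [h, hTv₃]
    · have := hrange₂ v h; omega
  obtain ⟨K₄, H, hK₄, hH, hlen₄⟩ := hT₂.exists_two_tours hV hℓ hG₃
    (B := Finset.univ.filter fun v => degE T₂ v = 1)
    (fun v hv => by simpa using hv) (fun v hv => hT₂' v (by simpa using hv))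
    (fun v hv => by rw [hfinal]; simpa using hv)
    (fun v hv => by rw [hfinal]; exact hT₂' v (by simpa using hv))
  exact ⟨K₁, K₂, K₃, K₄, H, hK₁, hK₂, hK₃, hK₄, hH, by linarith⟩

lemma degE_eq_of_V1E {T : Finset (Sym2 V)} (hd : ∀ v, degE T v ≤ 2) {a w b : V}
    (ha : s(a, w) ∈ T) (hb : s(w, b) ∈ T) (hab : a ≠ b) (h : V1E T = Set.univ \ {w}) (v : V) :
    degE T v = if v = w then 2 else 1 := by
  split_ifs with hv
  · subst hv
    rw [Sym2.eq_swap] at ha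
    exact (hd v).antisymm (two_le_degE ha hb hab)
  · have : v ∈ V1E T := by rw [h]; simpa using hv
    exact this

/-- Lemma 16 of the paper. -/
theorem stmt15 (ℓ : Sym2 V → ℝ) (hℓ : ∀ e : Sym2 V, 0 ≤ ℓ e)
    (hn : 17 ≤ Fintype.card V) (hodd : Odd (Fintype.card V))
    (S Cstar T T' : Finset (Sym2 V)) (v1 v2 v3 v4 : V)
    (hS : IsKFactor 2 S) (hSnot : ¬ IsTourE S)
    (hdist : v1 ≠ v2 ∧ v1 ≠ v3 ∧ v1 ≠ v4 ∧ v2 ≠ v3 ∧ v2 ≠ v4 ∧ v3 ≠ v4)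
    (hCstar : IsCycleE Cstar) (hCstarS : Cstar ⊆ S)
    (hP : ({s(v1, v2), s(v2, v3), s(v3, v4)} : Finset (Sym2 V)) ⊆ Cstar)
    (hT : IsPathCoverE T) (hT12 : s(v1, v2) ∈ T) (hT23 : s(v2, v3) ∈ T)
    (hV1T : V1E T = Set.univ \ {v2})
    (hT' : IsPathCoverE T') (hT'23 : s(v2, v3) ∈ T') (hT'34 : s(v3, v4) ∈ T')
    (hV1T' : V1E T' = Set.univ \ {v3}) :
    ∃ H1 H2 H3 H4 H5 H6 H7 H8 H H' : Finset (Sym2 V),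
      IsTourE H1 ∧ IsTourE H2 ∧ IsTourE H3 ∧ IsTourE H4 ∧
      IsTourE H5 ∧ IsTourE H6 ∧ IsTourE H7 ∧ IsTourE H8 ∧
      IsTourE H ∧ IsTourE H' ∧
      lenE ℓ H1 + lenE ℓ H2 + lenE ℓ H3 + lenE ℓ H4 +
        lenE ℓ H5 + lenE ℓ H6 + lenE ℓ H7 + lenE ℓ H8 ≤
        2 * (2 * lenE ℓ S + lenE ℓ T + lenE ℓ T') + lenE ℓ H + lenE ℓ H' -
          2 * ℓ s(v2, v3) := by
  obtain ⟨hv₁₂, hv₁₃, hv₁₄, hv₂₃, hv₂₄, hv₃₄⟩ := hdist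
  have hV : 3 ≤ Fintype.card V := by omega
  obtain ⟨hSs, hSd⟩ := hS
  have hSd' : ∀ v, degE S v ≤ 2 := fun v => (hSd v).le
  have hD₁₂ : s(v1, v2) ∈ Cstar := hP (by simp)
  have hD₂₃ : s(v2, v3) ∈ Cstar := hP (by simp)
  have hD₃₄ : s(v3, v4) ∈ Cstar := hP (by simp)
  have hDv₁ : v1 ∈ VsetE Cstar := ⟨_, hD₁₂, Sym2.mem_mk_left _ _⟩
  have hDv₂ : v2 ∈ VsetE Cstar := ⟨_, hD₂₃, Sym2.mem_mk_left _ _⟩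
  have hDv₃ : v3 ∈ VsetE Cstar := ⟨_, hD₂₃, Sym2.mem_mk_right _ _⟩
  have hDv₄ : v4 ∈ VsetE Cstar := ⟨_, hD₃₄, Sym2.mem_mk_right _ _⟩
  have hdT : ∀ v, degE T v = if v = v2 then 2 else 1 :=
    degE_eq_of_V1E hT.1.2 hT12 hT23 hv₁₃ hV1T
  have hdT' : ∀ v, degE T' v = if v = v3 then 2 else 1 :=
    degE_eq_of_V1E hT'.1.2 hT'23 hT'34 hv₂₄ hV1T'
  have hTl : LinForestE T := ⟨hT.1.1, hT.1.2, isAcyclic_of_acyclicE hT.1.1 hT.2.2⟩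
  have hTl' : LinForestE T' := ⟨hT'.1.1, hT'.1.2, isAcyclic_of_acyclicE hT'.1.1 hT'.2.2⟩
  obtain ⟨C, hCS, hC, hC₃₄⟩ : ∃ C ⊆ S, IsCycleE C ∧ s(v3, v4) ∉ C := by
    have hsub := Finset.erase_subset s(v3, v4) S
    by_cases hlin : LinForestE (S.erase s(v3, v4))
    · refine absurd ?_ hSnot
      have := hlin.isTourE_insert hV hv₃₄ fun v => ?_
      · rwa [Finset.insert_erase (hCstarS hD₃₄)] at this
      · have := degE_erase (hCstarS hD₃₄) v
        rw [hSd] at this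
        split_ifs at this ⊢ <;> omega
    · obtain ⟨C, hCS, hC⟩ := exists_isCycleE_of_not_linForestE (fun e he => hSs e (hsub he))
        (fun v => (degE_mono hsub v).trans (hSd' v)) hlin
      exact ⟨C, hCS.trans hsub, hC, fun h => by simpa using hCS h⟩
  have hCD : C ≠ Cstar := fun h => hC₃₄ (h ▸ hD₃₄)
  have hne : ∀ {v w}, v ∈ VsetE Cstar → w ∈ VsetE C → v ≠ w := by
    rintro v _ hv hw rfl
    exact hCD (hC.eq_of_mem hCS hCstar hCstarS hSd' hw hv)
  have hnr : ∀ {F : Finset (Sym2 V)} {v w}, F ⊆ S → v ∈ VsetE Cstar → w ∈ VsetE C →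
      ¬ (graphE F).Reachable v w := fun hF hv hw hr =>
    hne (hCstar.mem_VsetE_of_reachable hCstarS hSd' hv (hr.mono (graphE_mono hF))) hw rfl
  obtain ⟨x, y, S₁, T₁, hxy, -, hxyne, hS₁S, hS₁, hT₁, hsum₁, hlen₁, hdeg₁⟩ :=
    exists_linForestE_pair ℓ hSs hSd hC hCS hCstar hCstarS hCD hTl hD₃₄ hDv₂ hT12 hT23
      hv₁₃ hv₁₄ hv₁₂ hv₂₃ hv₂₄ hdT s(v1, v1)
  rw [Sym2.eq_swap] at hD₁₂ hT'23 hT'34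
  obtain ⟨z, w, S₂, T₂, hzw, hne', hzwne, hS₂S, hS₂, hT₂, hsum₂, hlen₂, hdeg₂⟩ :=
    exists_linForestE_pair ℓ hSs hSd hC hCS hCstar hCstarS hCD hTl' hD₁₂ hDv₃ hT'34 hT'23
      hv₂₄.symm hv₁₄.symm hv₃₄.symm hv₂₃.symm hv₁₃.symm hdT' s(x, y)
  have hx : x ∈ VsetE C := ⟨_, hxy, Sym2.mem_mk_left _ _⟩
  have hy : y ∈ VsetE C := ⟨_, hxy, Sym2.mem_mk_right _ _⟩
  have hz : z ∈ VsetE C := ⟨_, hzw, Sym2.mem_mk_left _ _⟩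
  have hw : w ∈ VsetE C := ⟨_, hzw, Sym2.mem_mk_right _ _⟩
  have hne'' : ¬ ((z = x ∧ w = y) ∨ (z = y ∧ w = x)) := fun h => hne' (Sym2.eq_iff.2 h)
  obtain ⟨t₁, ht₁, ht₁C, ht₁'⟩ : ∃ t, (t = x ∨ t = y) ∧ t ∈ VsetE C ∧ ¬ (t = z ∨ t = w) := by
    by_cases h : x = z ∨ x = w
    · refine ⟨y, Or.inr rfl, hy, ?_⟩
      rintro (rfl | rfl) <;> rcases h with rfl | rfl <;> simp_all
    · exact ⟨x, Or.inl rfl, hx, h⟩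
  obtain ⟨t₂, ht₂, ht₂C, ht₂'⟩ : ∃ t, (t = z ∨ t = w) ∧ t ∈ VsetE C ∧ ¬ (t = x ∨ t = y) := by
    by_cases h : z = x ∨ z = y
    · refine ⟨w, Or.inr rfl, hw, ?_⟩
      rintro (rfl | rfl) <;> rcases h with rfl | rfl <;> simp_all
    · exact ⟨z, Or.inl rfl, hz, h⟩
  obtain ⟨K₁, K₂, K₃, K₄, H, hK₁, hK₂, hK₃, hK₄, hH, hlen⟩ :=
    exists_four_tours hV hℓ hS₁ hS₂ hT₁ hT₂ hv₁₂ hv₁₃ hv₂₃ hv₃₄ hv₂₄ (hne hDv₁ ht₂C)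
      (hne hDv₄ ht₁C) hsum₁ hsum₂
      (by simp [hdeg₁ v1 (Or.inr hDv₁), hv₁₃, hv₁₄, hne hDv₁ hx, hne hDv₁ hy])
      (by simp [hdeg₁ v2 (Or.inr hDv₂), hv₂₃, hv₂₄, hne hDv₂ hx, hne hDv₂ hy])
      (by simp [hdeg₁ v3 (Or.inr hDv₃)])
      (by simp [hdeg₁ v4 (Or.inr hDv₄)])
      (by rw [hdeg₁ t₁ (Or.inl ht₁C), if_pos (Or.inr (Or.inr ht₁))])
      (by simp [hdeg₁ t₂ (Or.inl ht₂C), ht₂', (hne hDv₃ ht₂C).symm, (hne hDv₄ ht₂C).symm])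
      (by simp [hdeg₂ v1 (Or.inr hDv₁)])
      (by simp [hdeg₂ v2 (Or.inr hDv₂)])
      (by simp [hdeg₂ v3 (Or.inr hDv₃), hv₂₃.symm, hv₁₃.symm, hne hDv₃ hz, hne hDv₃ hw])
      (by simp [hdeg₂ t₁ (Or.inl ht₁C), ht₁', (hne hDv₁ ht₁C).symm, (hne hDv₂ ht₁C).symm])
      (by rw [hdeg₂ t₂ (Or.inl ht₂C), if_pos (Or.inr (Or.inr ht₂))])
      (hnr hS₁S hDv₃ ht₁C) (hnr hS₂S hDv₂ ht₂C)
  exact ⟨K₁, K₂, K₃, K₄, K₁, K₂, K₃, K₄, H, H, hK₁, hK₂, hK₃, hK₄, hK₁, hK₂, hK₃, hK₄, hH, hH,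
    by linarith⟩
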